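/- For every r > 2 there is a constant C depending only on r such that for every τ > 0 and every family A = (A_ξ)_{ξ∈ℝ} ⊂ ℂ for which the right-hand side norms are finite and the double integral converges absolutely, one has | ∫_ℝ ∫_ℝ i(ξ−η) A_η A_{ξ−η} conj(A_ξ) e^{2τ|ξ|} ⟨ξ⟩^{2r} dη dξ | ≤ C ( ‖|∂ₓ|^{1/2} A‖~²_{τ,r} ‖A‖~_{τ,r} + ‖|∂ₓ|^{1/2} A‖~_{τ,r} ‖A‖~²_{τ,r} ). -/

import Mathlib

open MeasureTheory Set Filter

noncomputable section

/-- Gaussian weight `ρ(y) = exp(y²/(8(1+t/ε)))`. -/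
def rho (ε t y : ℝ) : ℝ := Real.exp (y ^ 2 / (8 * (1 + t / ε)))

/-- Japanese bracket `⟨ξ⟩ = √(1+ξ²)`. -/
def brak (ξ : ℝ) : ℝ := Real.sqrt (1 + ξ ^ 2)

/-- Combined weight `ρ(y)² e^{2τ|ξ|} ⟨ξ⟩^{2s}` in the squared analytic norms. -/
def wgt (ε t τ s ξ y : ℝ) : ℝ :=
  (rho ε t y) ^ 2 * Real.exp (2 * τ * |ξ|) * brak ξ ^ (2 * s)

/-- Weight `e^{2τ|ξ|} ⟨ξ⟩^{2s}` for the squared analytic norms of boundary data. -/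
def aWgt (τ s ξ : ℝ) : ℝ := Real.exp (2 * τ * |ξ|) * brak ξ ^ (2 * s)

/-- Analytic norm `‖w‖_{τ,s}` (with Fourier multiplier `m`):
`(∫_ℝ ∫_0^∞ m(ξ) ρ(y)² |w_ξ(y)|² e^{2τ|ξ|} ⟨ξ⟩^{2s} dy dξ)^{1/2}`. -/
def wNorm (ε t τ s : ℝ) (m : ℝ → ℝ) (w : ℝ → ℝ → ℂ) : ℝ :=
  Real.sqrt (∫ ξ : ℝ, ∫ y in Ioi (0 : ℝ), m ξ * ‖w ξ y‖ ^ 2 * wgt ε t τ s ξ y)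

/-- Analytic norm `‖A‖~_{τ,s}` (with Fourier multiplier `m`):
`(∫_ℝ m(ξ) |A_ξ|² e^{2τ|ξ|} ⟨ξ⟩^{2s} dξ)^{1/2}`. -/
def aNorm (τ s : ℝ) (m : ℝ → ℝ) (A : ℝ → ℂ) : ℝ :=
  Real.sqrt (∫ ξ : ℝ, m ξ * ‖A ξ‖ ^ 2 * aWgt τ s ξ)

/-- Finiteness of the squared norm `‖·‖_{τ,s}` with multiplier `m`. -/
def wFinite (ε t τ s : ℝ) (m : ℝ → ℝ) (w : ℝ → ℝ → ℂ) : Prop :=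
  Integrable (fun p : ℝ × ℝ => m p.1 * ‖w p.1 p.2‖ ^ 2 * wgt ε t τ s p.1 p.2)
    ((volume : Measure ℝ).prod ((volume : Measure ℝ).restrict (Ioi 0)))

/-- Finiteness of the squared norm `‖·‖~_{τ,s}` with multiplier `m`. -/
def aFinite (τ s : ℝ) (m : ℝ → ℝ) (A : ℝ → ℂ) : Prop :=
  Integrable (fun ξ : ℝ => m ξ * ‖A ξ‖ ^ 2 * aWgt τ s ξ) (volume : Measure ℝ)


lemma brak_pos (x : ℝ) : 0 < brak x := by unfold brak; positivity

lemma one_le_brak (x : ℝ) : 1 ≤ brak x := by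
  unfold brak; rw [Real.one_le_sqrt]; nlinarith [sq_nonneg x]

lemma abs_le_brak (x : ℝ) : |x| ≤ brak x := by
  unfold brak; apply Real.abs_le_sqrt; linarith

lemma sqrt_abs_le_brak (x : ℝ) : Real.sqrt |x| ≤ brak x := by
  rw [Real.sqrt_le_iff]
  refine ⟨(brak_pos x).le, ?_⟩
  nlinarith [abs_le_brak x, one_le_brak x]

lemma brak_sq (x : ℝ) : brak x ^ 2 = 1 + x ^ 2 := by
  unfold brak; rw [Real.sq_sqrt]; positivity

lemma brak_add (x y : ℝ) : brak (x + y) ≤ brak x + brak y := by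
  have hx := brak_pos x
  have hy := brak_pos y
  suffices hs : brak (x + y) ^ 2 ≤ (brak x + brak y) ^ 2 from
    (sq_le_sq₀ (brak_pos _).le (by positivity)).1 hs
  have h : x * y ≤ brak x * brak y := by
    calc x * y ≤ |x| * |y| := by rw [← abs_mul]; exact le_abs_self _
      _ ≤ _ := mul_le_mul (abs_le_brak x) (abs_le_brak y) (abs_nonneg _) hx.le
  have := brak_sq x
  have := brak_sq y
  have := brak_sq (x + y)
  nlinarith

lemma brak_le_rpow {r : ℝ} (hr : 2 < r) (x : ℝ) : brak x ≤ brak x ^ r * (brak x)⁻¹ := by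
  rw [← div_eq_mul_inv, le_div_iff₀ (brak_pos x)]
  calc brak x * brak x = brak x ^ (2 : ℝ) := by
        rw [Real.rpow_two]; ring
    _ ≤ _ := Real.rpow_le_rpow_of_exponent_le (one_le_brak x) hr.le

lemma sqrt_abs_add (x y : ℝ) : Real.sqrt |x - y| ≤ Real.sqrt |x| + Real.sqrt |y| := by
  have h1 := Real.sqrt_nonneg |x|
  have h2 := Real.sqrt_nonneg |y|
  rw [Real.sqrt_le_iff]
  refine ⟨by positivity, ?_⟩
  have := Real.sq_sqrt (abs_nonneg x)
  have := Real.sq_sqrt (abs_nonneg y)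
  have := abs_sub x y
  nlinarith [mul_nonneg h1 h2]

lemma key_brak {r : ℝ} (hr : 2 < r) (x y : ℝ) :
    Real.sqrt |x - y| * brak x ^ r ≤ 2 ^ r * (brak y ^ r * brak (x - y) ^ r *
      ((brak (x - y))⁻¹ + Real.sqrt |x| * (brak y)⁻¹ + (brak y)⁻¹)) := by
  set z := x - y with hz
  have hxyz : brak x ≤ brak y + brak z := by
    have := brak_add y z
    rwa [show y + z = x by rw [hz]; ring] at this
  have by0 := brak_pos y
  have bz0 := brak_pos z
  have bx0 := brak_pos x
  have hy := brak_le_rpow hr y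
  have hzz := brak_le_rpow hr z
  have s0 := Real.sqrt_nonneg |x|
  have hsz : Real.sqrt |z| ≤ Real.sqrt |x| + Real.sqrt |y| := sqrt_abs_add x y
  have P1 : 0 ≤ brak y ^ r * (brak y)⁻¹ := by positivity
  have P2 : 0 ≤ brak z ^ r * (brak z)⁻¹ := by positivity
  rcases le_total (brak y) (brak z) with h | h
  · have h1 : brak x ^ r ≤ 2 ^ r * brak z ^ r := by
      rw [← Real.mul_rpow (by norm_num) bz0.le]
      exact Real.rpow_le_rpow bx0.le (by linarith) (by linarith)
    have h2 : Real.sqrt |z| ≤ brak y ^ r * ((brak z)⁻¹ + Real.sqrt |x| * (brak y)⁻¹ + (brak y)⁻¹) := by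
      have e1 := sqrt_abs_le_brak y
      have e2 := one_le_brak y
      have e3 : 0 ≤ brak y ^ r * (brak z)⁻¹ := by positivity
      have e4 : Real.sqrt |x| * 1 ≤ Real.sqrt |x| * (brak y ^ r * (brak y)⁻¹) :=
        mul_le_mul_of_nonneg_left (by linarith) s0
      nlinarith
    calc Real.sqrt |z| * brak x ^ r
        ≤ (brak y ^ r * ((brak z)⁻¹ + Real.sqrt |x| * (brak y)⁻¹ + (brak y)⁻¹)) * (2 ^ r * brak z ^ r) :=
          mul_le_mul h2 h1 (by positivity) (by positivity)
      _ = _ := by ring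
  · have h1 : brak x ^ r ≤ 2 ^ r * brak y ^ r := by
      rw [← Real.mul_rpow (by norm_num) by0.le]
      exact Real.rpow_le_rpow bx0.le (by linarith) (by linarith)
    have h2 : Real.sqrt |z| ≤ brak z ^ r * ((brak z)⁻¹ + Real.sqrt |x| * (brak y)⁻¹ + (brak y)⁻¹) := by
      have e1 := sqrt_abs_le_brak z
      have e3 : 0 ≤ brak z ^ r * (Real.sqrt |x| * (brak y)⁻¹ + (brak y)⁻¹) := by positivity
      nlinarith
    calc Real.sqrt |z| * brak x ^ r
        ≤ (brak z ^ r * ((brak z)⁻¹ + Real.sqrt |x| * (brak y)⁻¹ + (brak y)⁻¹)) * (2 ^ r * brak y ^ r) :=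
          mul_le_mul h2 h1 (by positivity) (by positivity)
      _ = _ := by ring

/-- square root of the norm density -/
def dens (τ r : ℝ) (m : ℝ → ℝ) (A : ℝ → ℂ) (ξ : ℝ) : ℝ :=
  Real.sqrt (m ξ * ‖A ξ‖ ^ 2 * aWgt τ r ξ)

def hW (τ r ξ : ℝ) : ℝ := Real.exp (τ * |ξ|) * brak ξ ^ r

lemma hW_sq (τ r ξ : ℝ) : aWgt τ r ξ = hW τ r ξ ^ 2 := by
  unfold aWgt hW
  rw [mul_pow, ← Real.exp_nat_mul, ← Real.rpow_mul_natCast (brak_pos ξ).le]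
  congr 2
  · push_cast; ring
  · push_cast; ring

lemma hW_pos (τ r ξ : ℝ) : 0 < hW τ r ξ := by
  have := brak_pos ξ
  unfold hW; positivity

lemma dens_eq (τ r : ℝ) (m : ℝ → ℝ) (A : ℝ → ℂ) (ξ : ℝ) (hm : 0 ≤ m ξ) :
    dens τ r m A ξ = Real.sqrt (m ξ) * ‖A ξ‖ * hW τ r ξ := by
  unfold dens
  rw [hW_sq, Real.sqrt_mul (by positivity), Real.sqrt_mul hm, Real.sqrt_sq (norm_nonneg _),
    Real.sqrt_sq (hW_pos _ _ _).le]

lemma key_W {r τ : ℝ} (hr : 2 < r) (hτ : 0 < τ) (x y : ℝ) :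
    Real.sqrt |x - y| * hW τ r x ≤ 2 ^ r * (hW τ r y * hW τ r (x - y) *
      ((brak (x - y))⁻¹ + Real.sqrt |x| * (brak y)⁻¹ + (brak y)⁻¹)) := by
  have h := key_brak hr x y
  have he : Real.exp (τ * |x|) ≤ Real.exp (τ * |y|) * Real.exp (τ * |x - y|) := by
    rw [← Real.exp_add, ← mul_add]
    apply Real.exp_le_exp.2
    apply mul_le_mul_of_nonneg_left _ hτ.le
    have := abs_add_le y (x - y)
    rwa [show y + (x - y) = x by ring] at this
  have := brak_pos x
  have := mul_le_mul he h (by positivity) (by positivity)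
  unfold hW
  calc _ = _ := by ring
    _ ≤ _ := this
    _ = _ := by ring

lemma key_pt {r τ : ℝ} (hr : 2 < r) (hτ : 0 < τ) (A : ℝ → ℂ) (x y : ℝ) :
    ‖Complex.I * ((x - y : ℝ) : ℂ) * A y * A (x - y) * (starRingEnd ℂ) (A x) *
            ((aWgt τ r x : ℝ) : ℂ)‖ ≤
    2 ^ r * ((dens τ r (fun _ => 1) A x * dens τ r (fun _ => 1) A y *
          (dens τ r (fun ξ => |ξ|) A (x - y) * (brak (x - y))⁻¹))
      + (dens τ r (fun ξ => |ξ|) A x * dens τ r (fun ξ => |ξ|) A (x - y) *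
          (dens τ r (fun _ => 1) A y * (brak y)⁻¹))
      + (dens τ r (fun _ => 1) A x * dens τ r (fun ξ => |ξ|) A (x - y) *
          (dens τ r (fun _ => 1) A y * (brak y)⁻¹))) := by
  have hw := hW_pos τ r x
  have hk := key_W hr hτ x y
  simp only [dens_eq τ r (fun _ => 1) A _ zero_le_one, dens_eq τ r (fun ξ => |ξ|) A _ (abs_nonneg _),
    Real.sqrt_one]
  simp only [norm_mul, Complex.norm_I, Complex.norm_real, RCLike.norm_conj, Real.norm_eq_abs]
  rw [hW_sq, abs_of_nonneg (sq_nonneg (hW τ r x))]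
  nth_rewrite 1 [← Real.mul_self_sqrt (abs_nonneg (x - y))]
  have := mul_le_mul_of_nonneg_left hk
    (show 0 ≤ Real.sqrt |x - y| * ‖A y‖ * ‖A (x - y)‖ * ‖A x‖ * hW τ r x by positivity)
  calc _ = _ := by ring
    _ ≤ _ := this
    _ = _ := by ring

open scoped ENNReal

def L2 (f : ℝ → ℝ≥0∞) : ℝ≥0∞ := (∫⁻ x, f x ^ (2 : ℝ)) ^ (1 / 2 : ℝ)

lemma holder2 {f g : ℝ → ℝ≥0∞} (hf : AEMeasurable f) (hg : AEMeasurable g) :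
    ∫⁻ x, f x * g x ≤ L2 f * L2 g :=
  ENNReal.lintegral_mul_le_Lp_mul_Lq volume Real.HolderConjugate.two_two hf hg

lemma aem_sub {g : ℝ → ℝ≥0∞} (hg : AEMeasurable g) :
    AEMeasurable (fun p : ℝ × ℝ => g (p.1 - p.2)) (volume.prod volume) :=
  hg.comp_quasiMeasurePreserving (quasiMeasurePreserving_sub_of_right_invariant volume volume)

lemma young1 {f g k : ℝ → ℝ≥0∞} (hf : AEMeasurable f) (hg : AEMeasurable g)
    (hk : AEMeasurable k) :
    ∫⁻ x, ∫⁻ y, f x * g (x - y) * k y ≤ L2 f * L2 g * ∫⁻ y, k y := by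
  rw [lintegral_lintegral_swap]
  · rw [← lintegral_const_mul'' _ hk]
    apply lintegral_mono
    intro y
    have hgy : AEMeasurable (fun x => g (x - y)) :=
      hg.comp_quasiMeasurePreserving (measurePreserving_sub_right volume y).quasiMeasurePreserving
    dsimp only
    have hfg : AEMeasurable (fun x => f x * g (x - y)) := hf.mul hgy
    rw [lintegral_mul_const'' _ hfg]
    gcongr
    refine (holder2 hf hgy).trans (le_of_eq ?_)
    congr 1
    unfold L2
    rw [lintegral_sub_right_eq_self (fun x => g x ^ (2 : ℝ)) y]
  · exact (hf.comp_fst.mul (aem_sub hg)).mul hk.comp_snd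

lemma young2 {f g k : ℝ → ℝ≥0∞} (hf : AEMeasurable f) (hg : AEMeasurable g)
    (hk : AEMeasurable k) :
    ∫⁻ x, ∫⁻ y, f x * g y * k (x - y) ≤ L2 f * L2 g * ∫⁻ y, k y := by
  refine le_trans (le_of_eq ?_) (young1 hf hg hk)
  apply lintegral_congr
  intro x
  rw [← lintegral_sub_left_eq_self (fun y => f x * g (x - y) * k y) x]
  simp

def bI (x : ℝ) : ℝ≥0∞ := ENNReal.ofReal (brak x)⁻¹

lemma bI_meas : Measurable bI := by
  unfold bI brak; fun_prop

lemma L2_bI : L2 bI ≠ ∞ := by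
  unfold L2
  apply ENNReal.rpow_ne_top_of_nonneg (by norm_num)
  have : ∀ x, bI x ^ (2 : ℝ) = ENNReal.ofReal ((1 + x ^ 2)⁻¹) := by
    intro x
    unfold bI
    have := brak_pos x
    rw [ENNReal.ofReal_rpow_of_nonneg (by positivity) (by norm_num), Real.rpow_two, inv_pow, brak_sq]
  simp_rw [this]
  exact integrable_inv_one_add_sq.lintegral_lt_top.ne

lemma dens_aem {τ r : ℝ} {m : ℝ → ℝ} {A : ℝ → ℂ} (h : aFinite τ r m A) :
    AEMeasurable (fun x => ENNReal.ofReal (dens τ r m A x)) := by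
  have h1 : AEMeasurable (fun ξ : ℝ => m ξ * ‖A ξ‖ ^ 2 * aWgt τ r ξ) := h.aestronglyMeasurable.aemeasurable
  exact (h1.sqrt).ennreal_ofReal

lemma L2_dens {τ r : ℝ} {m : ℝ → ℝ} {A : ℝ → ℂ} (hm : ∀ x, 0 ≤ m x) (h : aFinite τ r m A) :
    L2 (fun x => ENNReal.ofReal (dens τ r m A x)) = ENNReal.ofReal (aNorm τ r m A) := by
  have hn : ∀ x, 0 ≤ m x * ‖A x‖ ^ 2 * aWgt τ r x := fun x => by
    have := hm x
    rw [hW_sq]; positivity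
  unfold L2 aNorm
  have : ∀ x, ENNReal.ofReal (dens τ r m A x) ^ (2 : ℝ)
      = ENNReal.ofReal (m x * ‖A x‖ ^ 2 * aWgt τ r x) := by
    intro x
    unfold dens
    rw [ENNReal.ofReal_rpow_of_nonneg (Real.sqrt_nonneg _) (by norm_num), Real.rpow_two,
      Real.sq_sqrt (hn x)]
  simp_rw [this]
  rw [← ofReal_integral_eq_lintegral_ofReal h (ae_of_all _ hn),
    ENNReal.ofReal_rpow_of_nonneg (integral_nonneg hn) (by norm_num), Real.sqrt_eq_rpow]

/-- **Bound on `T_{𝒜,2}`** (second estimate of (3.16a) in the paper): for `r > 2` there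
is `C = C(r)` with `|∫∫ i(ξ−η) A_η A_{ξ−η} conj(A_ξ) e^{2τ|ξ|}⟨ξ⟩^{2r} dη dξ|
≤ C (‖|∂ₓ|^{1/2}A‖~²_{τ,r} ‖A‖~_{τ,r} + ‖|∂ₓ|^{1/2}A‖~_{τ,r} ‖A‖~²_{τ,r})`. -/
theorem TA2_bound :
    ∀ r : ℝ, 2 < r →
    ∃ C : ℝ, 0 < C ∧
    ∀ (τ : ℝ), 0 < τ →
    ∀ A : ℝ → ℂ,
      aFinite τ r (fun ξ => |ξ|) A →
      aFinite τ r (fun _ => 1) A →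
      Integrable (fun p : ℝ × ℝ =>
        Complex.I * ((p.1 - p.2 : ℝ) : ℂ) * A p.2 * A (p.1 - p.2) *
          (starRingEnd ℂ) (A p.1) * ((aWgt τ r p.1 : ℝ) : ℂ))
        ((volume : Measure ℝ).prod (volume : Measure ℝ)) →
      (∀ ξ : ℝ, Integrable (fun η : ℝ =>
        Complex.I * ((ξ - η : ℝ) : ℂ) * A η * A (ξ - η))) →
      ‖∫ ξ : ℝ, ∫ η : ℝ,
          Complex.I * ((ξ - η : ℝ) : ℂ) * A η * A (ξ - η) * (starRingEnd ℂ) (A ξ) *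
            ((aWgt τ r ξ : ℝ) : ℂ)‖
        ≤ C * ((aNorm τ r (fun ξ => |ξ|) A) ^ 2 * aNorm τ r (fun _ => 1) A
            + aNorm τ r (fun ξ => |ξ|) A * (aNorm τ r (fun _ => 1) A) ^ 2) := by
  intro r hr
  refine ⟨2 ^ r * (L2 bI).toReal * 2 + 1, by positivity, ?_⟩
  intro τ hτ A hH hN _ _
  set U : ℝ → ℝ≥0∞ := fun x => ENNReal.ofReal (dens τ r (fun _ => 1) A x) with hU
  set V : ℝ → ℝ≥0∞ := fun x => ENNReal.ofReal (dens τ r (fun ξ => |ξ|) A x) with hV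
  have mU : AEMeasurable U := dens_aem hN
  have mV : AEMeasurable V := dens_aem hH
  have mB : AEMeasurable bI := bI_meas.aemeasurable
  set N := aNorm τ r (fun _ => 1) A with hNdef
  set H := aNorm τ r (fun ξ => |ξ|) A with hHdef
  have LU : L2 U = ENNReal.ofReal N := L2_dens (fun _ => zero_le_one) hN
  have LV : L2 V = ENNReal.ofReal H := L2_dens (fun x => abs_nonneg x) hH
  have N0 : 0 ≤ N := Real.sqrt_nonneg _
  have H0 : 0 ≤ H := Real.sqrt_nonneg _
  set K := (L2 bI).toReal with hK
  have K0 : 0 ≤ K := ENNReal.toReal_nonneg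
  have LB : L2 bI = ENNReal.ofReal K := (ENNReal.ofReal_toReal L2_bI).symm
  have mUB : AEMeasurable (fun y => U y * bI y) := mU.mul mB
  have mVB : AEMeasurable (fun y => V y * bI y) := mV.mul mB
  have T1 := (young2 mU mU mVB).trans (mul_le_mul_right (holder2 mV mB) (L2 U * L2 U))
  have T2 := (young1 mV mV mUB).trans (mul_le_mul_right (holder2 mU mB) (L2 V * L2 V))
  have T3 := (young1 mU mV mUB).trans (mul_le_mul_right (holder2 mU mB) (L2 U * L2 V))
  have main : ∫⁻ x, ∫⁻ y, ‖Complex.I * ((x - y : ℝ) : ℂ) * A y * A (x - y) *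
      (starRingEnd ℂ) (A x) * ((aWgt τ r x : ℝ) : ℂ)‖ₑ ≤
      ENNReal.ofReal (2 ^ r) * ((∫⁻ x, ∫⁻ y, U x * U y * (V (x - y) * bI (x - y)))
        + (∫⁻ x, ∫⁻ y, V x * V (x - y) * (U y * bI y))
        + (∫⁻ x, ∫⁻ y, U x * V (x - y) * (U y * bI y))) := by
    have pm1 : AEMeasurable (fun p : ℝ × ℝ => U p.1 * U p.2 * (V (p.1 - p.2) * bI (p.1 - p.2)))
        (volume.prod volume) := (mU.comp_fst.mul mU.comp_snd).mul (aem_sub mVB)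
    have pm2 : AEMeasurable (fun p : ℝ × ℝ => V p.1 * V (p.1 - p.2) * (U p.2 * bI p.2))
        (volume.prod volume) := (mV.comp_fst.mul (aem_sub mV)).mul mUB.comp_snd
    have pm3 : AEMeasurable (fun p : ℝ × ℝ => U p.1 * V (p.1 - p.2) * (U p.2 * bI p.2))
        (volume.prod volume) := (mU.comp_fst.mul (aem_sub mV)).mul mUB.comp_snd
    have pm12 : AEMeasurable (fun p : ℝ × ℝ => U p.1 * U p.2 * (V (p.1 - p.2) * bI (p.1 - p.2))
        + V p.1 * V (p.1 - p.2) * (U p.2 * bI p.2)) (volume.prod volume) := pm1.add pm2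
    have pm123 : AEMeasurable (fun p : ℝ × ℝ => U p.1 * U p.2 * (V (p.1 - p.2) * bI (p.1 - p.2))
        + V p.1 * V (p.1 - p.2) * (U p.2 * bI p.2)
        + U p.1 * V (p.1 - p.2) * (U p.2 * bI p.2)) (volume.prod volume) := pm12.add pm3
    have q1 := lintegral_prod _ pm1
    have q2 := lintegral_prod _ pm2
    have q3 := lintegral_prod _ pm3
    dsimp only at q1 q2 q3
    rw [← q1, ← q2, ← q3, ← lintegral_add_left' pm1, ← lintegral_add_left' pm12,
      ← lintegral_const_mul'' _ pm123, lintegral_prod _ (pm123.const_mul _)]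
    refine lintegral_mono fun x => lintegral_mono fun y => ?_
    rw [← ofReal_norm]
    refine (ENNReal.ofReal_le_ofReal (key_pt hr hτ A x y)).trans (le_of_eq ?_)
    have d1 : ∀ z, 0 ≤ dens τ r (fun _ => 1) A z := fun z => Real.sqrt_nonneg _
    have d2 : ∀ z, 0 ≤ dens τ r (fun ξ => |ξ|) A z := fun z => Real.sqrt_nonneg _
    have d3 : ∀ z, 0 ≤ (brak z)⁻¹ := fun z => (inv_pos.2 (brak_pos z)).le
    have := d1 x; have := d1 y; have := d2 x; have := d2 (x - y); have := d3 y
    have := d3 (x - y)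
    simp only [hU, hV, bI]
    rw [ENNReal.ofReal_mul (by positivity), ENNReal.ofReal_add (by positivity) (by positivity),
      ENNReal.ofReal_add (by positivity) (by positivity)]
    simp only [ENNReal.ofReal_mul, mul_nonneg, *]
  have fin : ‖∫ ξ : ℝ, ∫ η : ℝ,
          Complex.I * ((ξ - η : ℝ) : ℂ) * A η * A (ξ - η) * (starRingEnd ℂ) (A ξ) *
            ((aWgt τ r ξ : ℝ) : ℂ)‖ₑ ≤ ENNReal.ofReal (2 ^ r * (N * N * (H * K) + H * H * (N * K)
              + N * H * (N * K))) := by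
    refine (enorm_integral_le_lintegral_enorm _).trans ?_
    refine (lintegral_mono fun x => enorm_integral_le_lintegral_enorm _).trans ?_
    refine main.trans ?_
    rw [ENNReal.ofReal_mul (by positivity), ENNReal.ofReal_add (by positivity) (by positivity),
      ENNReal.ofReal_add (by positivity) (by positivity)]
    rw [LU, LV, LB] at T1 T2 T3
    simp only [ENNReal.ofReal_mul, mul_nonneg, N0, H0, K0]
    gcongr
  rw [← ofReal_norm, ENNReal.ofReal_le_ofReal_iff (by positivity)] at fin
  refine fin.trans ?_
  have e0 : 0 ≤ (2 : ℝ) ^ r * K := by positivity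
  have e1 : 0 ≤ H ^ 2 * N := by positivity
  have e2 : 0 ≤ H * N ^ 2 := by positivity
  nlinarith [mul_nonneg e0 e1]
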